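/- With G, n, t, k and the labeling v_1, …, v_n as in the setup: the minimum degree of G satisfies δ(G) > n/(t+1) − 1. -/

import Mathlib

/-- A graph `G` is `t`-tough if `|S| ≥ t · c(G − S)` for every vertex subset `S`
whose removal leaves at least two connected components. -/
def SimpleGraph.Tough {V : Type*} [Fintype V] (t : ℚ) (G : SimpleGraph V) : Prop :=
  ∀ S : Finset V,
    2 ≤ Nat.card ((G.induce ((↑S : Set V)ᶜ)).ConnectedComponent) →
    t * (Nat.card ((G.induce ((↑S : Set V)ᶜ)).ConnectedComponent) : ℚ) ≤ (S.card : ℚ)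

/-- In a `t`-tough graph, a vertex which is not adjacent to all other vertices has degree at
least `2t`. -/
theorem SimpleGraph.Tough.two_mul_le_degree {V : Type*} [Fintype V] {G : SimpleGraph V}
    [DecidableRel G.Adj] {t : ℕ} (htough : G.Tough (t : ℚ)) {x y : V} (hne : x ≠ y)
    (hxy : ¬ G.Adj x y) : 2 * t ≤ G.degree x := by
  have hx : x ∈ ((↑(G.neighborFinset x) : Set V)ᶜ) := by simp
  have hy : y ∈ ((↑(G.neighborFinset x) : Set V)ᶜ) := by simpa using hxy
  have hcard : 2 ≤ Nat.card
      ((G.induce ((↑(G.neighborFinset x) : Set V)ᶜ)).ConnectedComponent) := by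
    have : Nontrivial ((G.induce ((↑(G.neighborFinset x) : Set V)ᶜ)).ConnectedComponent) := by
      refine ⟨SimpleGraph.connectedComponentMk _ ⟨x, hx⟩,
        SimpleGraph.connectedComponentMk _ ⟨y, hy⟩, fun h => ?_⟩
      obtain ⟨p⟩ := SimpleGraph.ConnectedComponent.exact h
      cases p with
      | nil => exact hne rfl
      | @cons _ w _ hadj _ =>
        have hw := w.2
        simp only [Set.mem_compl_iff, Finset.mem_coe, SimpleGraph.mem_neighborFinset] at hw
        exact hw hadj
    exact Finite.one_lt_card_iff_nontrivial.mpr this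
  have h := htough _ hcard
  rw [SimpleGraph.card_neighborFinset_eq_degree] at h
  have h' : t * Nat.card
      ((G.induce ((↑(G.neighborFinset x) : Set V)ᶜ)).ConnectedComponent) ≤ G.degree x := by
    exact_mod_cast h
  nlinarith

/-- If `v` is injective on a finite set `s` of indices and `x` is adjacent to `v q` for every
`q ∈ s`, then `x` has degree at least `|s|`. -/
theorem SimpleGraph.card_le_degree_of_forall_adj {V ι : Type*} [Fintype V] {G : SimpleGraph V}
    [DecidableRel G.Adj] {v : ι → V} {s : Finset ι} {x : V} (hinj : Set.InjOn v s)
    (hadj : ∀ q ∈ s, G.Adj x (v q)) : s.card ≤ G.degree x := by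
  classical
  rw [← Finset.card_image_of_injOn hinj, ← SimpleGraph.card_neighborFinset_eq_degree]
  refine Finset.card_le_card fun y hy => ?_
  obtain ⟨q, hq, rfl⟩ := Finset.mem_image.mp hy
  simpa using hadj q hq

/-- With the full setup (non-Hamiltonian `t`-closed `t`-tough graph, degree
condition, `k` minimal with `d_k ≤ k`, `k < n/2`): the minimum degree of `G`
satisfies `δ(G) > n/(t+1) − 1`. -/
theorem minDegree_gt
    {V : Type*} [Fintype V] [DecidableEq V] (G : SimpleGraph V) [DecidableRel G.Adj]
    (n t : ℕ) (ht : 4 ≤ t) (hn : Fintype.card V = n) (hn3 : 3 ≤ n)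
    (htough : SimpleGraph.Tough (t : ℚ) G) (hnotham : ¬ G.IsHamiltonian)
    (v : ℕ → V) (hbij : Set.BijOn v (Set.Icc 1 n) Set.univ)
    (hmono : ∀ i j, 1 ≤ i → i ≤ j → j ≤ n → G.degree (v i) ≤ G.degree (v j))
    (hcond : ∀ i, 1 ≤ i → 2 * i < n →
      G.degree (v i) ≤ i → n - i ≤ G.degree (v (n - i + t)))
    (hclosed : ∀ a b : V, a ≠ b → ¬ G.Adj a b →
      (G.degree a : ℤ) + (G.degree b : ℤ) < (n : ℤ) - (t : ℤ))
    (k : ℕ) (hk1 : 1 ≤ k) (hk2 : 2 * k < n) (hkd : G.degree (v k) ≤ k)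
    (hkmin : ∀ i, 1 ≤ i → 2 * i < n → G.degree (v i) ≤ i → k ≤ i) :
    (n : ℚ) / ((t : ℚ) + 1) - 1 < (G.minDegree : ℚ) := by
  have hinj : Set.InjOn v (Set.Icc 1 n) := hbij.injOn
  have hadj : ∀ i p, 1 ≤ i → i ≤ n → 1 ≤ p → p ≤ n → i ≠ p →
      n ≤ G.degree (v i) + G.degree (v p) + t → G.Adj (v i) (v p) := by
    intro i p hi hi' hp hp' hne hsum
    by_contra hna
    have := hclosed (v i) (v p) (fun h => hne (hinj ⟨hi, hi'⟩ ⟨hp, hp'⟩ h)) hna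
    omega
  have lower : ∀ i p, 1 ≤ i → i < p → p ≤ n → n ≤ G.degree (v i) + G.degree (v p) + t →
      n + 1 ≤ G.degree (v i) + p := by
    intro i p hi hip hp hsum
    have h := SimpleGraph.card_le_degree_of_forall_adj (G := G) (v := v)
      (s := Finset.Icc p n) (x := v i)
      (hinj.mono fun q hq => by
        rw [Finset.coe_Icc] at hq
        exact ⟨by have := hq.1; omega, hq.2⟩)
      (fun q hq => by
        rw [Finset.mem_Icc] at hq
        have := hmono p q (by omega) hq.1 hq.2
        exact hadj i q hi (by omega) (by omega) hq.2 (by omega) (by omega))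
    rw [Nat.card_Icc] at h
    omega
  have upper : ∀ i p, 1 ≤ i → i < p → p ≤ n → n ≤ G.degree (v i) + G.degree (v p) + t →
      n ≤ G.degree (v p) + i := by
    intro i p hi hip hp hsum
    have h := SimpleGraph.card_le_degree_of_forall_adj (G := G) (v := v)
      (s := (Finset.Icc i n).erase p) (x := v p)
      (hinj.mono fun q hq => by
        rw [Finset.mem_coe, Finset.mem_erase, Finset.mem_Icc] at hq
        exact ⟨by omega, hq.2.2⟩)
      (fun q hq => by
        rw [Finset.mem_erase, Finset.mem_Icc] at hq
        have := hmono i q hi hq.2.1 hq.2.2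
        exact hadj p q (by omega) hp (by omega) hq.2.2 (Ne.symm hq.1) (by omega))
    rw [Finset.card_erase_of_mem (Finset.mem_Icc.mpr ⟨hip.le, hp⟩), Nat.card_Icc] at h
    omega
  have two_mul_le : ∀ i, 1 ≤ i → 2 * i < n → G.degree (v i) ≤ i → 2 * t ≤ G.degree (v i) := by
    intro i hi hin hdi
    by_contra hlt
    have h := SimpleGraph.card_le_degree_of_forall_adj (G := G) (v := v)
      (s := (Finset.Icc 1 n).erase i) (x := v i)
      (hinj.mono fun q hq => by
        rw [Finset.mem_coe, Finset.mem_erase, Finset.mem_Icc] at hq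
        exact hq.2)
      (fun q hq => by
        rw [Finset.mem_erase, Finset.mem_Icc] at hq
        by_contra hna
        exact hlt (htough.two_mul_le_degree
          (fun h => hq.1 (hinj ⟨hq.2.1, hq.2.2⟩ ⟨hi, by omega⟩ h.symm)) hna))
    rw [Finset.card_erase_of_mem (Finset.mem_Icc.mpr ⟨hi, by omega⟩), Nat.card_Icc] at h
    omega
  have lt_degree_add : ∀ j, 1 ≤ j → 2 * j < n → G.degree (v j) ≤ j → j < G.degree (v j) + t := by
    intro j hj hjn hdj
    by_contra hlt
    have hle := hmono (G.degree (v j) + t) j (by omega) (by omega) (by omega)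
    have hc := hcond (G.degree (v j) + t) (by omega) (by omega) (by omega)
    rw [show n - (G.degree (v j) + t) + t = n - G.degree (v j) by omega] at hc
    have := lower j (n - G.degree (v j)) hj (by omega) (by omega) (by omega)
    omega
  obtain ⟨J, hJ⟩ : ∃ J, J = (n - 1) / 2 := ⟨_, rfl⟩
  have hdJ : G.degree (v J) ≤ J := by
    let P : ℕ → Prop := fun j => 1 ≤ j ∧ G.degree (v j) ≤ j
    have hPk : P k := ⟨hk1, hkd⟩
    have hkJ : k ≤ J := by omega
    obtain ⟨j, hj⟩ : ∃ j, j = Nat.findGreatest P J := ⟨_, rfl⟩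
    have hPj : P j := hj ▸ Nat.findGreatest_spec hkJ hPk
    have hjJ : j ≤ J := hj ▸ Nat.findGreatest_le J
    have hmax : ∀ i, j < i → i ≤ J → i < G.degree (v i) := by
      intro i hji hiJ
      by_contra hlt
      exact Nat.findGreatest_is_greatest (hj ▸ hji) hiJ ⟨by omega, by omega⟩
    obtain ⟨hj1, hdj⟩ := hPj
    rcases hjJ.eq_or_lt with rfl | hlt
    · exact hdj
    exfalso
    have hclique : ∀ s, s ≤ J → j ≤ s → n ≤ G.degree (v (s + 1)) + s + 1 := by
      intro s hs
      induction hs using Nat.decreasingInduction with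
      | self =>
        intro _
        have h1 := hmono J (J + 1) (by omega) (by omega) (by omega)
        have h2 := hmax J hlt le_rfl
        omega
      | of_succ s hs ih =>
        intro hjs
        have h1 := ih (by omega)
        have h2 := hmax (s + 1) (by omega) (by omega)
        have := lower (s + 1) (s + 1 + 1) (by omega) (by omega) (by omega) (by omega)
        omega
    have h1 := hclique j hjJ le_rfl
    have h2 := lt_degree_add j hj1 (by omega) hdj
    have := lower j (j + 1) hj1 (by omega) (by omega) (by omega)
    omega
  have hJ1 : 1 ≤ J := by omega
  have hJn : 2 * J < n := by omega
  have hJt : 2 * t ≤ J := (two_mul_le J hJ1 hJn hdJ).trans hdJ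
  have hp := hcond J hJ1 hJn hdJ
  have hlow : ∀ c, c ≤ J → 1 ≤ c → J + 1 ≤ G.degree (v c) + t := by
    intro c hc
    induction hc using Nat.decreasingInduction with
    | self => exact fun _ => lt_degree_add J hJ1 hJn hdJ
    | of_succ c hc ih =>
      intro hc1
      have h1 := ih (by omega)
      have h2 := upper (c + 1) (n - J + t) (by omega) (by omega) (by omega) (by omega)
      have h3 : c < G.degree (v c) + t := by
        rcases le_or_gt (G.degree (v c)) c with h | h
        · exact lt_degree_add c hc1 (by omega) h
        · omega
      have := lower c (n - J + t) hc1 (by omega) (by omega) (by omega)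
      omega
  have hmin : J + 1 ≤ G.minDegree + t := by
    have : Nonempty V := ⟨v 1⟩
    obtain ⟨x, hx⟩ := G.exists_minimal_degree_vertex
    obtain ⟨i, hi, rfl⟩ := hbij.surjOn (Set.mem_univ x)
    have h1 := hmono 1 i le_rfl hi.1 hi.2
    have h2 := hlow 1 hJ1 le_rfl
    omega
  have hnJ : n ≤ 2 * J + 2 := by omega
  have hfinal : n < (G.minDegree + 1) * (t + 1) := by
    nlinarith
  have hfinal' : (n : ℚ) < ((G.minDegree : ℚ) + 1) * ((t : ℚ) + 1) := by
    exact_mod_cast hfinal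
  rw [sub_lt_iff_lt_add, div_lt_iff₀ (by positivity)]
  exact hfinal'
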